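/- Let n ≥ 1 be an integer, b ∈ [0,1), r > 0, and p > (1+b)/(1−b). Let f : B_r* → ℝ be continuously differentiable with K := ∫_{B_r*} z^b |∇f(x,z)|² dx dz < ∞. Define A := {(x,z) ∈ B_r* : f(x,z) ≤ 0}, B := {(x,z) ∈ B_r* : f(x,z) ≥ 1}, and C := {(x,z) ∈ B_r* : 0 < f(x,z) < 1}. Then there is a constant C₀, depending only on n, b, p and r (and independent of f), such that |A|_w · |B|_w ≤ C₀ · (|C|_w)^{1/(2p)} · K^{1/2}. -/

import Mathlib

open MeasureTheory Set

/-- The box `B_r* = [-r,r]^n × [0,r] ⊆ ℝⁿ × ℝ₊`. -/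
def Bstar (n : ℕ) (r : ℝ) : Set ((Fin n → ℝ) × ℝ) :=
  (Set.univ.pi fun _ : Fin n => Set.Icc (-r) r) ×ˢ Set.Icc 0 r

open Module in
/-- Dilating by a factor `t ≥ 1/2` and translating costs at most `2 ^ d` in a Lebesgue integral. -/
lemma lintegral_add_smul_le {E : Type*} [NormedAddCommGroup E] [NormedSpace ℝ E]
    [FiniteDimensional ℝ E] [MeasurableSpace E] [BorelSpace E] (μ : Measure E)
    [μ.IsAddHaarMeasure] {H : E → ENNReal} (hH : Measurable H) (a : E) {t : ℝ} (ht : 1 / 2 ≤ t) :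
    ∫⁻ y, H (a + t • y) ∂μ ≤ 2 ^ finrank ℝ E * ∫⁻ y, H y ∂μ := by
  have ht0 : 0 < t := by linarith
  have hm : Measurable fun y => H (a + y) := hH.comp (measurable_const_add a)
  have h : ∫⁻ y, H (a + t • y) ∂μ
      = ENNReal.ofReal |(t ^ finrank ℝ E)⁻¹| * ∫⁻ y, H y ∂μ := by
    rw [← lintegral_map (f := fun y => H (a + y)) hm (measurable_const_smul t),
      Measure.map_addHaar_smul μ ht0.ne', lintegral_smul_measure, lintegral_add_left_eq_self,
      smul_eq_mul]
  rw [h]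
  gcongr
  rw [abs_of_pos (by positivity), ← inv_pow]
  calc ENNReal.ofReal (t⁻¹ ^ finrank ℝ E) ≤ ENNReal.ofReal (2 ^ finrank ℝ E) := by
        gcongr
        rw [inv_le_comm₀ ht0 two_pos]
        linarith
    _ = 2 ^ finrank ℝ E := by simp [ENNReal.ofReal_pow]

/-- A continuous function going from `≤ 0` to `≥ 1` has a full transition interval. -/
lemma exists_transition_Ioo {φ : ℝ → ℝ} (hφ : ContinuousOn φ (Icc 0 1)) (h0 : φ 0 ≤ 0)
    (h1 : 1 ≤ φ 1) :
    ∃ a b, 0 ≤ a ∧ a ≤ b ∧ b ≤ 1 ∧ φ a ≤ 0 ∧ 1 ≤ φ b ∧ ∀ t ∈ Ioo a b, 0 < φ t ∧ φ t < 1 := by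
  have hA : IsCompact (Icc 0 1 ∩ φ ⁻¹' Iic 0) :=
    isCompact_Icc.of_isClosed_subset (hφ.preimage_isClosed_of_isClosed isClosed_Icc isClosed_Iic)
      inter_subset_left
  obtain ⟨a, ⟨⟨ha0, ha1⟩, hφa⟩, ha⟩ := hA.exists_isGreatest ⟨0, by simp, h0⟩
  have hsub : Icc a 1 ⊆ Icc 0 1 := Icc_subset_Icc_left ha0
  have hB : IsCompact (Icc a 1 ∩ φ ⁻¹' Ici 1) :=
    isCompact_Icc.of_isClosed_subset
      ((hφ.mono hsub).preimage_isClosed_of_isClosed isClosed_Icc isClosed_Ici) inter_subset_left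
  obtain ⟨b, ⟨⟨hab, hb1⟩, hφb⟩, hb⟩ := hB.exists_isLeast ⟨1, by simpa using ha1, h1⟩
  refine ⟨a, b, ha0, hab, hb1, hφa, hφb, fun t ht => ⟨?_, ?_⟩⟩
  · by_contra! h
    exact ht.1.not_ge (ha ⟨⟨ha0.trans ht.1.le, ht.2.le.trans hb1⟩, h⟩)
  · by_contra! h
    exact ht.2.not_ge (hb ⟨⟨ht.1.le, ht.2.le.trans hb1⟩, h⟩)

/-- Along a segment from `{f ≤ 0}` to `{f ≥ 1}`, the gradient of `f` restricted to the transition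
set has integral at least the inverse of the length of the segment. -/
lemma one_le_lintegral_segment {E : Type*} [NormedAddCommGroup E] [NormedSpace ℝ E] {S : Set E}
    (hS : Convex ℝ S) {f : E → ℝ} (hf : ContDiffOn ℝ 1 f S) {P Q : E} (hP : P ∈ S) (hQ : Q ∈ S)
    (hfP : f P ≤ 0) (hfQ : 1 ≤ f Q) :
    1 ≤ ∫⁻ t in Icc (0 : ℝ) 1, ‖Q - P‖ₑ *
      {q ∈ S | 0 < f q ∧ f q < 1}.indicator (fun q => ‖fderivWithin ℝ f S q‖ₑ)
        ((1 - t) • P + t • Q) := by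
  set γ : ℝ → E := fun t => (1 - t) • P + t • Q with hγ
  have hmaps : MapsTo γ (Icc 0 1) S := fun t ht =>
    hS hP hQ (sub_nonneg.2 ht.2) ht.1 (by ring)
  have hφ : ContDiffOn ℝ 1 (f ∘ γ) (Icc 0 1) :=
    hf.comp (by fun_prop : ContDiff ℝ 1 γ).contDiffOn hmaps
  obtain ⟨a, b, ha, hab, hb, hfa, hfb, hI⟩ := exists_transition_Ioo hφ.continuousOn
    (by simpa [γ] using hfP) (by simpa [γ] using hfQ)
  have hsub : Icc a b ⊆ Icc 0 1 := Icc_subset_Icc ha hb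
  have hne : a < b := by
    refine lt_of_le_of_ne hab ?_
    rintro rfl
    linarith
  calc (1 : ENNReal) ≤ ‖(f ∘ γ) b - (f ∘ γ) a‖ₑ := by
        rw [Real.enorm_eq_ofReal (by linarith), ENNReal.one_le_ofReal]
        linarith
    _ ≤ ∫⁻ t in Icc a b, ‖derivWithin (f ∘ γ) (Icc a b) t‖ₑ :=
        enorm_sub_le_lintegral_derivWithin_Icc_of_contDiffOn_Icc (hφ.mono hsub) hab
    _ = ∫⁻ t in Ioo a b, ‖derivWithin (f ∘ γ) (Icc a b) t‖ₑ := by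
        rw [Measure.restrict_congr_set Ioo_ae_eq_Icc]
    _ ≤ ∫⁻ t in Ioo a b, ‖Q - P‖ₑ *
          {q ∈ S | 0 < f q ∧ f q < 1}.indicator (fun q => ‖fderivWithin ℝ f S q‖ₑ) (γ t) := by
        refine setLIntegral_mono' measurableSet_Ioo fun t ht => ?_
        have htI : t ∈ Icc a b := Ioo_subset_Icc_self ht
        have hγS : γ t ∈ S := hmaps (hsub htI)
        have hγd : HasDerivAt γ (Q - P) t := by
          have h1 : HasDerivAt (fun t : ℝ => (1 - t) • P) ((-1 : ℝ) • P) t :=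
            ((hasDerivAt_id t).const_sub 1).smul_const P
          have h2 : HasDerivAt (fun t : ℝ => t • Q) ((1 : ℝ) • Q) t :=
            (hasDerivAt_id t).smul_const Q
          exact (h1.add h2).congr_deriv (by module)
        have hd : HasDerivWithinAt (f ∘ γ) (fderivWithin ℝ f S (γ t) (Q - P)) (Icc a b) t :=
          ((hf.differentiableOn one_ne_zero) _ hγS).hasFDerivWithinAt.comp_hasDerivWithinAt t
            hγd.hasDerivWithinAt (hmaps.mono_left hsub)
        rw [hd.derivWithin (uniqueDiffOn_Icc hne t htI),
          indicator_of_mem (show γ t ∈ {q ∈ S | 0 < f q ∧ f q < 1} from ⟨hγS, hI t ht⟩), mul_comm]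
        exact ContinuousLinearMap.le_opENorm _ _
    _ ≤ _ := lintegral_mono_set (Ioo_subset_Icc_self.trans hsub)

/-- Averaging a function over all segments with endpoints in `S`, provided that averaging over
dilated copies with ratio in `[1/2, 1]` centred at a point of `S` is bounded. -/
lemma measure_mul_le_of_segment {E : Type*} [NormedAddCommGroup E] [NormedSpace ℝ E]
    [SecondCountableTopology E] [MeasurableSpace E] [BorelSpace E]
    (ν : Measure E) [IsFiniteMeasure ν] {S A B : Set E} (hS : ∀ᵐ q ∂ν, q ∈ S)
    (hA : MeasurableSet A) (hB : MeasurableSet B) {c : ENNReal} {G : E → ENNReal}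
    (hG : Measurable G)
    (hν : ∀ P ∈ S, ∀ t ∈ Icc (1 / 2 : ℝ) 1,
      ∫⁻ Q, G ((1 - t) • P + t • Q) ∂ν ≤ c * ∫⁻ q, G q ∂ν)
    (hAB : ∀ P ∈ A, ∀ Q ∈ B, 1 ≤ ∫⁻ t in Icc (0 : ℝ) 1, G ((1 - t) • P + t • Q)) :
    ν A * ν B ≤ c * ν univ * ∫⁻ q, G q ∂ν := by
  have hmeas : Measurable fun x : (E × E) × ℝ => G ((1 - x.2) • x.1.1 + x.2 • x.1.2) :=
    hG.comp (by fun_prop)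
  have hslice : ∀ t ∈ Icc (0 : ℝ) 1,
      ∫⁻ x : E × E, G ((1 - t) • x.1 + t • x.2) ∂ν.prod ν ≤ c * ν univ * ∫⁻ q, G q ∂ν := by
    intro t ht
    have hm : Measurable fun x : E × E => G ((1 - t) • x.1 + t • x.2) := hG.comp (by fun_prop)
    have hc : ∫⁻ _ : E, c * ∫⁻ q, G q ∂ν ∂ν = c * ν univ * ∫⁻ q, G q ∂ν := by
      rw [lintegral_const]
      ring
    rw [← hc]
    rcases le_total (1 / 2) t with h | h
    · rw [lintegral_prod _ hm.aemeasurable]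
      refine lintegral_mono_ae ?_
      filter_upwards [hS] with P hP using hν P hP t ⟨h, ht.2⟩
    · rw [lintegral_prod_symm _ hm.aemeasurable]
      refine lintegral_mono_ae ?_
      filter_upwards [hS] with P hP
      refine le_trans (le_of_eq ?_) (hν P hP (1 - t) ⟨by linarith, by linarith [ht.1]⟩)
      refine lintegral_congr fun Q => ?_
      rw [sub_sub_cancel, add_comm]
  calc ν A * ν B = ∫⁻ x, (A ×ˢ B).indicator 1 x ∂ν.prod ν := by
        rw [lintegral_indicator_one (hA.prod hB), Measure.prod_prod]
    _ ≤ ∫⁻ x : E × E, (∫⁻ t in Icc (0 : ℝ) 1, G ((1 - t) • x.1 + t • x.2)) ∂ν.prod ν := by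
        refine lintegral_mono fun x => ?_
        by_cases hx : x ∈ A ×ˢ B
        · rw [indicator_of_mem hx]
          exact hAB _ hx.1 _ hx.2
        · simp [indicator_of_notMem hx]
    _ = ∫⁻ t in Icc (0 : ℝ) 1, ∫⁻ x : E × E, G ((1 - t) • x.1 + t • x.2) ∂ν.prod ν :=
        lintegral_lintegral_swap hmeas.aemeasurable
    _ ≤ ∫⁻ _ in Icc (0 : ℝ) 1, c * ν univ * ∫⁻ q, G q ∂ν :=
        setLIntegral_mono' measurableSet_Icc hslice
    _ = c * ν univ * ∫⁻ q, G q ∂ν := by simp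

/-- The measure with density `z ^ b` on the box. -/
noncomputable def boxMeasure (n : ℕ) (b r : ℝ) : Measure ((Fin n → ℝ) × ℝ) :=
  (volume.restrict (Bstar n r)).withDensity fun q => ENNReal.ofReal (q.2 ^ b)

lemma isCompact_Bstar (n : ℕ) (r : ℝ) : IsCompact (Bstar n r) :=
  (isCompact_univ_pi fun _ => isCompact_Icc).prod isCompact_Icc

lemma measurableSet_Bstar (n : ℕ) (r : ℝ) : MeasurableSet (Bstar n r) :=
  (isCompact_Bstar n r).measurableSet

lemma convex_Bstar (n : ℕ) (r : ℝ) : Convex ℝ (Bstar n r) :=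
  (convex_pi fun _ _ => convex_Icc _ _).prod (convex_Icc _ _)

lemma uniqueDiffOn_Bstar (n : ℕ) {r : ℝ} (hr : 0 < r) : UniqueDiffOn ℝ (Bstar n r) :=
  (UniqueDiffOn.univ_pi fun _ => uniqueDiffOn_Icc (by linarith)).prod (uniqueDiffOn_Icc hr)

lemma measurable_weight (n : ℕ) (b : ℝ) :
    Measurable fun q : (Fin n → ℝ) × ℝ => q.2 ^ b :=
  measurable_snd.pow_const b

lemma enorm_sub_le_of_mem_Bstar {n : ℕ} {r : ℝ} {P Q : (Fin n → ℝ) × ℝ} (hr : 0 < r)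
    (hP : P ∈ Bstar n r) (hQ : Q ∈ Bstar n r) : ‖Q - P‖ₑ ≤ ENNReal.ofReal (2 * r) := by
  rw [← ofReal_norm]
  gcongr
  refine norm_prod_le_iff.2 ⟨(pi_norm_le_iff_of_nonneg (by positivity)).2 fun i => ?_, ?_⟩
  · have h1 := hP.1 i trivial
    have h2 := hQ.1 i trivial
    exact abs_le.2 ⟨by simp; linarith [h1.2, h2.1], by simp; linarith [h1.1, h2.2]⟩
  · have h1 := hP.2
    have h2 := hQ.2
    exact abs_le.2 ⟨by simp; linarith [h1.2, h2.1], by simp; linarith [h1.1, h2.2]⟩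

lemma isFiniteMeasure_boxMeasure (n : ℕ) {b r : ℝ} (hb : 0 ≤ b) :
    IsFiniteMeasure (boxMeasure n b r) := by
  have hc : Continuous fun q : (Fin n → ℝ) × ℝ => q.2 ^ b :=
    continuous_snd.rpow_const fun _ => Or.inr hb
  exact isFiniteMeasure_withDensity_ofReal
    (hc.continuousOn.integrableOn_compact (isCompact_Bstar n r)).hasFiniteIntegral

lemma ae_mem_boxMeasure (n : ℕ) (b r : ℝ) : ∀ᵐ q ∂boxMeasure n b r, q ∈ Bstar n r :=
  (withDensity_absolutelyContinuous _ _).ae_le (ae_restrict_mem (measurableSet_Bstar n r))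

lemma lintegral_boxMeasure (n : ℕ) (b r : ℝ) {G : (Fin n → ℝ) × ℝ → ENNReal}
    (hG : Measurable G) :
    ∫⁻ q, G q ∂boxMeasure n b r = ∫⁻ q in Bstar n r, ENNReal.ofReal (q.2 ^ b) * G q :=
  lintegral_withDensity_eq_lintegral_mul _ (measurable_weight n b).ennreal_ofReal hG

lemma setIntegral_weight_eq (n : ℕ) (b r : ℝ) {A : Set ((Fin n → ℝ) × ℝ)}
    (hA : MeasurableSet A) (hAS : A ⊆ Bstar n r) :
    ∫ q in A, q.2 ^ b = (boxMeasure n b r A).toReal := by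
  rw [boxMeasure, withDensity_apply _ hA, Measure.restrict_restrict hA,
    inter_eq_self_of_subset_left hAS]
  refine integral_eq_lintegral_of_nonneg_ae ?_ (measurable_weight n b).aestronglyMeasurable
  filter_upwards [ae_restrict_mem hA] with q hq using Real.rpow_nonneg (hAS hq).2.1 b

open Module in
lemma lintegral_boxMeasure_dilation_le (n : ℕ) {b r : ℝ} (hb : 0 ≤ b)
    {G : (Fin n → ℝ) × ℝ → ENNReal} (hG : Measurable G) {P : (Fin n → ℝ) × ℝ}
    (hP : P ∈ Bstar n r) {t : ℝ} (ht : t ∈ Icc (1 / 2 : ℝ) 1) :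
    ∫⁻ Q, G ((1 - t) • P + t • Q) ∂boxMeasure n b r ≤
      ENNReal.ofReal (2 ^ b) * 2 ^ finrank ℝ ((Fin n → ℝ) × ℝ) *
        ∫⁻ q, G q ∂boxMeasure n b r := by
  have hS := measurableSet_Bstar n r
  set H : (Fin n → ℝ) × ℝ → ENNReal :=
    (Bstar n r).indicator fun q => ENNReal.ofReal (q.2 ^ b) * G q with hH
  have hHm : Measurable H := ((measurable_weight n b).ennreal_ofReal.mul hG).indicator hS
  have hGm : Measurable fun Q => G ((1 - t) • P + t • Q) := hG.comp (by fun_prop)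
  rw [lintegral_boxMeasure n b r hGm, lintegral_boxMeasure n b r hG,
    ← lintegral_indicator hS fun q => ENNReal.ofReal (q.2 ^ b) * G q, ← hH, mul_assoc]
  calc ∫⁻ Q in Bstar n r, ENNReal.ofReal (Q.2 ^ b) * G ((1 - t) • P + t • Q)
      ≤ ∫⁻ Q in Bstar n r, ENNReal.ofReal (2 ^ b) * H ((1 - t) • P + t • Q) := by
        refine setLIntegral_mono' hS fun Q hQ => ?_
        have hmem : (1 - t) • P + t • Q ∈ Bstar n r :=
          convex_Bstar n r hP hQ (sub_nonneg.2 ht.2) (by linarith [ht.1]) (by ring)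
        rw [hH, indicator_of_mem hmem, ← mul_assoc, ← ENNReal.ofReal_mul (by positivity),
          ← Real.mul_rpow two_pos.le hmem.2.1]
        gcongr
        · exact hQ.2.1
        · have h1 : 0 ≤ (1 - t) * P.2 := mul_nonneg (sub_nonneg.2 ht.2) hP.2.1
          have h2 : 1 / 2 * Q.2 ≤ t * Q.2 := mul_le_mul_of_nonneg_right ht.1 hQ.2.1
          simp only [Prod.snd_add, Prod.smul_snd, smul_eq_mul]
          linarith
    _ ≤ ∫⁻ Q, ENNReal.ofReal (2 ^ b) * H ((1 - t) • P + t • Q) := setLIntegral_le_lintegral _ _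
    _ = ENNReal.ofReal (2 ^ b) * ∫⁻ Q, H ((1 - t) • P + t • Q) :=
        lintegral_const_mul _ (hHm.comp (by fun_prop))
    _ ≤ _ := by
        have : (volume : Measure ((Fin n → ℝ) × ℝ)).IsAddHaarMeasure :=
          Measure.prod.instIsAddHaarMeasure volume volume
        gcongr
        exact lintegral_add_smul_le volume hHm _ ht.1

/-- The Cauchy-Schwarz inequality on a set. -/
lemma lintegral_indicator_le_sqrt {α : Type*} [MeasurableSpace α] (ν : Measure α) {C : Set α}
    (hC : MeasurableSet C) {F : α → ENNReal} (hF : Measurable F) :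
    ∫⁻ q, C.indicator F q ∂ν ≤ ν C ^ (1 / 2 : ℝ) * (∫⁻ q, F q ^ 2 ∂ν) ^ (1 / 2 : ℝ) := by
  have h := ENNReal.lintegral_mul_le_Lp_mul_Lq ν (p := 2) (q := 2)
    (Real.HolderConjugate.two_two) (f := C.indicator 1) (g := F)
    (measurable_one.indicator hC).aemeasurable hF.aemeasurable
  have h1 : ∀ q, (C.indicator (1 : α → ENNReal) q) ^ (2 : ℝ) = C.indicator 1 q := fun q => by
    by_cases hq : q ∈ C <;> simp [hq]
  have h2 : ∀ q, (C.indicator (1 : α → ENNReal) * F) q = C.indicator F q := fun q => by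
    by_cases hq : q ∈ C <;> simp [hq]
  simp_rw [h1, h2, lintegral_indicator_one hC] at h
  simpa using h

/-- The isoperimetric inequality for `boxMeasure`, with the exponent `1/2`. -/
lemma boxMeasure_isoperimetric (n : ℕ) {b r : ℝ} (hb : 0 ≤ b) (hr : 0 < r)
    {f : (Fin n → ℝ) × ℝ → ℝ} (hf : ContDiffOn ℝ 1 f (Bstar n r))
    (hA : MeasurableSet {q ∈ Bstar n r | f q ≤ 0}) (hB : MeasurableSet {q ∈ Bstar n r | 1 ≤ f q})
    (hC : MeasurableSet {q ∈ Bstar n r | 0 < f q ∧ f q < 1}) :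
    boxMeasure n b r {q ∈ Bstar n r | f q ≤ 0} * boxMeasure n b r {q ∈ Bstar n r | 1 ≤ f q} ≤
      ENNReal.ofReal (2 ^ b) * 2 ^ Module.finrank ℝ ((Fin n → ℝ) × ℝ) *
        boxMeasure n b r univ * ENNReal.ofReal (2 * r) *
        (boxMeasure n b r {q ∈ Bstar n r | 0 < f q ∧ f q < 1} ^ (1 / 2 : ℝ) *
        (∫⁻ q in Bstar n r, ENNReal.ofReal
          (q.2 ^ b * ‖fderivWithin ℝ f (Bstar n r) q‖ ^ 2)) ^ (1 / 2 : ℝ)) := by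
  have := isFiniteMeasure_boxMeasure n (r := r) hb
  have hS := measurableSet_Bstar n r
  set C := {q ∈ Bstar n r | 0 < f q ∧ f q < 1} with hCdef
  set F : (Fin n → ℝ) × ℝ → ENNReal :=
    (Bstar n r).indicator fun q => ‖fderivWithin ℝ f (Bstar n r) q‖ₑ with hF
  have hFm : Measurable F := by
    classical
    rw [hF, ← piecewise_eq_indicator]
    exact ContinuousOn.measurable_piecewise
      (hf.continuousOn_fderivWithin (uniqueDiffOn_Bstar n hr) le_rfl).enorm
      continuousOn_const hS
  have hCF : C.indicator F = C.indicator fun q => ‖fderivWithin ℝ f (Bstar n r) q‖ₑ := by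
    rw [hF, indicator_indicator, inter_eq_self_of_subset_left fun q hq => hq.1]
  have hK : ∫⁻ q, F q ^ 2 ∂boxMeasure n b r = ∫⁻ q in Bstar n r, ENNReal.ofReal
      (q.2 ^ b * ‖fderivWithin ℝ f (Bstar n r) q‖ ^ 2) := by
    rw [lintegral_boxMeasure n b r (hFm.pow_const 2)]
    refine setLIntegral_congr_fun hS fun q hq => ?_
    simp only [hF, indicator_of_mem hq]
    rw [ENNReal.ofReal_mul (Real.rpow_nonneg hq.2.1 b), ENNReal.ofReal_pow (norm_nonneg _),
      ofReal_norm]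
  have hGm : Measurable (C.indicator F) := hFm.indicator hC
  have key := measure_mul_le_of_segment (boxMeasure n b r) (ae_mem_boxMeasure n b r) hA hB
    (G := fun q => ENNReal.ofReal (2 * r) * C.indicator F q) (hGm.const_mul _)
    (fun P hP t ht => lintegral_boxMeasure_dilation_le n hb (hGm.const_mul _) hP ht)
    (fun P hP Q hQ => by
      refine (one_le_lintegral_segment (convex_Bstar n r) hf hP.1 hQ.1 hP.2 hQ.2).trans ?_
      rw [← hCdef, ← hCF]
      gcongr
      exact enorm_sub_le_of_mem_Bstar hr hP.1 hQ.1)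
  refine key.trans ?_
  rw [lintegral_const_mul _ hGm, ← mul_assoc, ← hK]
  gcongr
  exact lintegral_indicator_le_sqrt _ hC hFm

/-- Weighted De Giorgi isoperimetric inequality (Lemma 3.5): for `f` continuously
differentiable on `B_r*` with finite weighted Dirichlet energy `K`,
`|A|_w |B|_w ≤ C₀ |C|_w^{1/(2p)} K^{1/2}`, where the constant `C₀` depends only on
`n`, `b`, `p` and `r` (not on `f`). -/
theorem weighted_deGiorgi_isoperimetric (n : ℕ) (hn : 1 ≤ n) (b p r : ℝ)
    (hb : b ∈ Set.Ico (0:ℝ) 1) (hr : 0 < r) (hp : (1 + b) / (1 - b) < p) :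
    ∃ C₀ : ℝ, 0 < C₀ ∧ ∀ f : (Fin n → ℝ) × ℝ → ℝ,
      ContDiffOn ℝ 1 f (Bstar n r) →
      IntegrableOn (fun q => q.2 ^ b * ‖fderivWithin ℝ f (Bstar n r) q‖ ^ 2)
        (Bstar n r) volume →
      (∫ q in {q ∈ Bstar n r | f q ≤ 0}, q.2 ^ b) *
          (∫ q in {q ∈ Bstar n r | 1 ≤ f q}, q.2 ^ b) ≤
        C₀ * (∫ q in {q ∈ Bstar n r | 0 < f q ∧ f q < 1}, q.2 ^ b) ^ (1 / (2 * p)) *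
          (∫ q in Bstar n r, q.2 ^ b * ‖fderivWithin ℝ f (Bstar n r) q‖ ^ 2) ^ (1/2 : ℝ) := by
  have hb1 : 0 < 1 - b := sub_pos.2 hb.2
  have hp1 : 1 < p := lt_of_le_of_lt ((one_le_div hb1).2 (by linarith [hb.1])) hp
  have hexp : 0 ≤ 1 / 2 - 1 / (2 * p) :=
    sub_nonneg.2 (one_div_le_one_div_of_le two_pos (by linarith))
  have := isFiniteMeasure_boxMeasure n (r := r) hb.1
  set M := (boxMeasure n b r univ).toReal with hM
  set c : ℝ := 2 ^ b * 2 ^ Module.finrank ℝ ((Fin n → ℝ) × ℝ) * M * (2 * r) with hc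
  have hM0 : 0 ≤ M := ENNReal.toReal_nonneg
  have hc0 : 0 ≤ c := by positivity
  refine ⟨c * M ^ (1 / 2 - 1 / (2 * p)) + 1, by positivity, fun f hf hK => ?_⟩
  have hcl := (isCompact_Bstar n r).isClosed
  have hA : MeasurableSet {q ∈ Bstar n r | f q ≤ 0} :=
    (hf.continuousOn.preimage_isClosed_of_isClosed hcl isClosed_Iic).measurableSet
  have hB : MeasurableSet {q ∈ Bstar n r | 1 ≤ f q} :=
    (hf.continuousOn.preimage_isClosed_of_isClosed hcl isClosed_Ici).measurableSet
  have hC : MeasurableSet {q ∈ Bstar n r | 0 < f q ∧ f q < 1} := by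
    convert (hcl.measurableSet.diff hA).diff hB using 1
    ext q
    simp only [mem_ofPred_eq, mem_sdiff]
    grind
  have hKeq : ∫ q in Bstar n r, q.2 ^ b * ‖fderivWithin ℝ f (Bstar n r) q‖ ^ 2 =
      (∫⁻ q in Bstar n r, ENNReal.ofReal
        (q.2 ^ b * ‖fderivWithin ℝ f (Bstar n r) q‖ ^ 2)).toReal := by
    refine integral_eq_lintegral_of_nonneg_ae ?_ hK.aestronglyMeasurable
    filter_upwards [ae_restrict_mem (measurableSet_Bstar n r)] with q hq
    exact mul_nonneg (Real.rpow_nonneg hq.2.1 b) (by positivity)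
  have key := boxMeasure_isoperimetric n hb.1 hr hf hA hB hC
  have hKtop : ∫⁻ q in Bstar n r, ENNReal.ofReal
      (q.2 ^ b * ‖fderivWithin ℝ f (Bstar n r) q‖ ^ 2) ≠ ⊤ := hK.lintegral_lt_top.ne
  rw [setIntegral_weight_eq n b r hA fun q hq => hq.1,
    setIntegral_weight_eq n b r hB fun q hq => hq.1,
    setIntegral_weight_eq n b r hC fun q hq => hq.1, hKeq]
  have hkey := ENNReal.toReal_mono (by finiteness) key
  simp only [ENNReal.toReal_mul, ← ENNReal.toReal_rpow, ENNReal.toReal_pow,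
    ENNReal.toReal_ofNat, ENNReal.toReal_ofReal (Real.rpow_nonneg two_pos.le b),
    ENNReal.toReal_ofReal (mul_pos two_pos hr).le, ← hM, ← hc] at hkey
  set m := (boxMeasure n b r {q ∈ Bstar n r | 0 < f q ∧ f q < 1}).toReal with hm
  set K := (∫⁻ q in Bstar n r, ENNReal.ofReal
      (q.2 ^ b * ‖fderivWithin ℝ f (Bstar n r) q‖ ^ 2)).toReal
  have hm0 : 0 ≤ m := ENNReal.toReal_nonneg
  have hK0 : 0 ≤ K := ENNReal.toReal_nonneg
  have hmM : m ≤ M := ENNReal.toReal_mono (measure_ne_top _ _) (measure_mono (subset_univ _))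
  have hpow : m ^ (1 / 2 : ℝ) ≤ M ^ (1 / 2 - 1 / (2 * p)) * m ^ (1 / (2 * p)) := by
    calc m ^ (1 / 2 : ℝ) = m ^ (1 / 2 - 1 / (2 * p)) * m ^ (1 / (2 * p)) := by
          rw [← Real.rpow_add_of_nonneg hm0 hexp (by positivity), sub_add_cancel]
      _ ≤ _ := by gcongr
  calc _ ≤ c * (m ^ (1 / 2 : ℝ) * K ^ (1 / 2 : ℝ)) := hkey
    _ ≤ c * ((M ^ (1 / 2 - 1 / (2 * p)) * m ^ (1 / (2 * p))) * K ^ (1 / 2 : ℝ)) := by gcongr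
    _ = c * M ^ (1 / 2 - 1 / (2 * p)) * m ^ (1 / (2 * p)) * K ^ (1 / 2 : ℝ) := by ring
    _ ≤ _ := by
      gcongr
      linarith
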